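/- Let d ≥ 2, let 0 < r_1 < ... < r_N, let F ∈ C^4 of the closed annulus {r_1 ≤ |x| ≤ r_N} in ℝ^d, and let I_4(F) be a biharmonic spline for the partition A(r_1,r_2),...,A(r_{N-1},r_N) interpolating F on all spheres |x| = r_j and matching the radial derivative of F on |x| = r_1 and |x| = r_N. Then ΔI_4(F) is the best L^2-approximation to ΔF among harmonic splines: for every harmonic spline φ for the partition A(r_1,r_2),...,A(r_{N-1},r_N), ‖ΔF - ΔI_4(F)‖_{L^2(A(r_1,r_N))} ≤ ‖ΔF - φ‖_{L^2(A(r_1,r_N))}. -/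

import Mathlib

open MeasureTheory Metric Set Filter Topology

noncomputable section

/-- The Laplace operator `Δf = ∑ ∂²f/∂xᵢ²` on `ℝᵈ`. -/
def laplacian {d : ℕ} {V : Type*} [NormedAddCommGroup V] [NormedSpace ℝ V]
    (f : EuclideanSpace ℝ (Fin d) → V) (x : EuclideanSpace ℝ (Fin d)) : V :=
  ∑ i : Fin d, iteratedFDeriv ℝ 2 f x ![EuclideanSpace.single i 1, EuclideanSpace.single i 1]

/-- The open annulus `A(r,R) = {x ∈ ℝᵈ : r < |x| < R}`. -/
def annulus (d : ℕ) (r R : ℝ) : Set (EuclideanSpace ℝ (Fin d)) := {x | r < ‖x‖ ∧ ‖x‖ < R}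

/-- The closed annulus `{x ∈ ℝᵈ : r ≤ |x| ≤ R}`. -/
def closedAnnulus (d : ℕ) (r R : ℝ) : Set (EuclideanSpace ℝ (Fin d)) := {x | r ≤ ‖x‖ ∧ ‖x‖ ≤ R}

/-- A function is harmonic on an open set `U` if it is `C²` there and `Δf = 0` on `U`. -/
def HarmonicOn {d : ℕ} (f : EuclideanSpace ℝ (Fin d) → ℝ)
    (U : Set (EuclideanSpace ℝ (Fin d))) : Prop :=
  ContDiffOn ℝ 2 f U ∧ ∀ x ∈ U, laplacian f x = 0

/-- A harmonic spline for the partition `A(r 0, r 1), ..., A(r (n-1), r n)`: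
continuous on the closed annulus and harmonic on each open subannulus. -/
def HarmonicSpline (d n : ℕ) (r : Fin (n + 1) → ℝ)
    (S : EuclideanSpace ℝ (Fin d) → ℝ) : Prop :=
  ContinuousOn S (closedAnnulus d (r 0) (r (Fin.last n))) ∧
  ∀ i : Fin n, HarmonicOn S (annulus d (r i.castSucc) (r i.succ))

/-- A function is biharmonic on an open set `U` if it is `C⁴` there and `Δ²f = 0` on `U`. -/
def BiharmonicOn {d : ℕ} (f : EuclideanSpace ℝ (Fin d) → ℝ)
    (U : Set (EuclideanSpace ℝ (Fin d))) : Prop :=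
  ContDiffOn ℝ 4 f U ∧ ∀ x ∈ U, laplacian (laplacian f) x = 0

/-- A biharmonic spline for the partition `A(r 0, r 1), ..., A(r (n-1), r n)`:
`C²` on the closed annulus and biharmonic on each open subannulus. -/
def BiharmonicSpline (d n : ℕ) (r : Fin (n + 1) → ℝ)
    (S : EuclideanSpace ℝ (Fin d) → ℝ) : Prop :=
  ContDiffOn ℝ 2 S (closedAnnulus d (r 0) (r (Fin.last n))) ∧
  ∀ i : Fin n, BiharmonicOn S (annulus d (r i.castSucc) (r i.succ))

theorem laplacian_eq_sum_fderiv_fderiv {d : ℕ} (f : EuclideanSpace ℝ (Fin d) → ℝ)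
    (x : EuclideanSpace ℝ (Fin d)) :
    laplacian f x = ∑ i, fderiv ℝ (fderiv ℝ f) x (EuclideanSpace.single i 1)
      (EuclideanSpace.single i 1) := by
  simp [laplacian, iteratedFDeriv_two_apply]

theorem ContDiffAt.differentiableAt_fderiv {E : Type*} [NormedAddCommGroup E] [NormedSpace ℝ E]
    {f : E → ℝ} {x : E} (hf : ContDiffAt ℝ 2 f x) : DifferentiableAt ℝ (fderiv ℝ f) x :=
  (hf.fderiv_right (m := 1) le_rfl).differentiableAt one_ne_zero

theorem laplacian_eq_sum_of_contDiffAt {d : ℕ} {f : EuclideanSpace ℝ (Fin d) → ℝ}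
    {x : EuclideanSpace ℝ (Fin d)} (hf : ContDiffAt ℝ 2 f x) :
    laplacian f x = ∑ i, fderiv ℝ (fun y => fderiv ℝ f y (EuclideanSpace.single i 1)) x
      (EuclideanSpace.single i 1) := by
  rw [laplacian_eq_sum_fderiv_fderiv]
  refine Finset.sum_congr rfl fun i _ => ?_
  rw [fderiv_clm_apply hf.differentiableAt_fderiv (differentiableAt_const _)]
  simp

theorem laplacian_congr_of_eventuallyEq {d : ℕ} {f g : EuclideanSpace ℝ (Fin d) → ℝ}
    {x : EuclideanSpace ℝ (Fin d)} (h : f =ᶠ[𝓝 x] g) : laplacian f x = laplacian g x := by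
  simp only [laplacian, (h.iteratedFDeriv ℝ 2).eq_of_nhds]

theorem laplacian_sub_of_contDiffAt {d : ℕ} {f g : EuclideanSpace ℝ (Fin d) → ℝ}
    {x : EuclideanSpace ℝ (Fin d)} (hf : ContDiffAt ℝ 2 f x) (hg : ContDiffAt ℝ 2 g x) :
    laplacian (fun y => f y - g y) x = laplacian f x - laplacian g x := by
  have h : iteratedFDeriv ℝ 2 (fun y => f y - g y) x
      = iteratedFDeriv ℝ 2 f x - iteratedFDeriv ℝ 2 g x := iteratedFDeriv_sub_apply hf hg
  simp [laplacian, h, Finset.sum_sub_distrib]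

theorem fderiv_mul_fderiv_apply {E : Type*} [NormedAddCommGroup E] [NormedSpace ℝ E]
    {f g : E → ℝ} {x : E} (hf : DifferentiableAt ℝ f x) (hg : ContDiffAt ℝ 2 g x) (v : E) :
    fderiv ℝ (fun y => f y * fderiv ℝ g y v) x v
      = f x * fderiv ℝ (fun y => fderiv ℝ g y v) x v + fderiv ℝ g x v * fderiv ℝ f x v := by
  rw [fderiv_fun_mul hf (hg.differentiableAt_fderiv.clm_apply (differentiableAt_const _))]
  simp

theorem laplacian_mul {d : ℕ} {f g : EuclideanSpace ℝ (Fin d) → ℝ}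
    {x : EuclideanSpace ℝ (Fin d)} (hf : ContDiffAt ℝ 2 f x) (hg : ContDiffAt ℝ 2 g x) :
    laplacian (fun y => f y * g y) x = f x * laplacian g x
      + 2 * ∑ i, fderiv ℝ f x (EuclideanSpace.single i 1) * fderiv ℝ g x (EuclideanSpace.single i 1)
      + g x * laplacian f x := by
  rw [laplacian_eq_sum_of_contDiffAt (hf.mul hg), laplacian_eq_sum_of_contDiffAt hf,
    laplacian_eq_sum_of_contDiffAt hg, Finset.mul_sum, Finset.mul_sum, Finset.mul_sum,
    ← Finset.sum_add_distrib, ← Finset.sum_add_distrib]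
  refine Finset.sum_congr rfl fun i _ => ?_
  set v : EuclideanSpace ℝ (Fin d) := EuclideanSpace.single i 1
  have hf1 : DifferentiableAt ℝ f x := hf.differentiableAt two_ne_zero
  have hg1 : DifferentiableAt ℝ g x := hg.differentiableAt two_ne_zero
  have h : (fun y => fderiv ℝ (fun y => f y * g y) y v)
      =ᶠ[𝓝 x] fun y => f y * fderiv ℝ g y v + g y * fderiv ℝ f y v := by
    filter_upwards [hf.eventually (by simp), hg.eventually (by simp)] with y hfy hgy
    rw [fderiv_fun_mul (hfy.differentiableAt two_ne_zero) (hgy.differentiableAt two_ne_zero)]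
    simp
  have hdf := hf.differentiableAt_fderiv.clm_apply (differentiableAt_const v)
  have hdg := hg.differentiableAt_fderiv.clm_apply (differentiableAt_const v)
  rw [h.fderiv_eq, fderiv_fun_add (hf1.fun_mul hdg) (hg1.fun_mul hdf), add_apply,
    fderiv_mul_fderiv_apply hf1 hg, fderiv_mul_fderiv_apply hg1 hf]
  ring

theorem fderiv_comp_norm_sq {d : ℕ} {H : ℝ → ℝ} (hH : Differentiable ℝ H)
    (x v : EuclideanSpace ℝ (Fin d)) :
    fderiv ℝ (fun y => H (‖y‖ ^ 2)) x v = deriv H (‖x‖ ^ 2) * (2 * inner ℝ x v) := by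
  have h1 : HasFDerivAt (fun y : EuclideanSpace ℝ (Fin d) => ‖y‖ ^ 2) (2 • innerSL ℝ x) x :=
    (hasStrictFDerivAt_norm_sq x).hasFDerivAt
  have h2 : HasFDerivAt (fun y : EuclideanSpace ℝ (Fin d) => H (‖y‖ ^ 2)) _ x :=
    (hH _).hasDerivAt.comp_hasFDerivAt x h1
  rw [h2.fderiv]
  simp

theorem laplacian_comp_norm_sq {d : ℕ} {H : ℝ → ℝ} (hH : ContDiff ℝ 2 H)
    (x : EuclideanSpace ℝ (Fin d)) :
    laplacian (fun y => H (‖y‖ ^ 2)) x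
      = 4 * ‖x‖ ^ 2 * deriv (deriv H) (‖x‖ ^ 2) + 2 * d * deriv H (‖x‖ ^ 2) := by
  have hH1 : Differentiable ℝ H := hH.differentiable two_ne_zero
  have hH2 : Differentiable ℝ (deriv H) :=
    ((contDiff_succ_iff_deriv (n := 1)).1 hH).2.2.differentiable one_ne_zero
  have hH3 : ContDiff ℝ 2 fun y : EuclideanSpace ℝ (Fin d) => H (‖y‖ ^ 2) :=
    hH.comp (contDiff_norm_sq ℝ)
  rw [laplacian_eq_sum_of_contDiffAt hH3.contDiffAt]
  have key : ∀ i : Fin d, fderiv ℝ (fun y => fderiv ℝ (fun y => H (‖y‖ ^ 2)) y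
      (EuclideanSpace.single i 1)) x (EuclideanSpace.single i 1)
      = 4 * deriv (deriv H) (‖x‖ ^ 2) * x i ^ 2 + 2 * deriv H (‖x‖ ^ 2) := by
    intro i
    have h : (fun y => fderiv ℝ (fun y => H (‖y‖ ^ 2)) y (EuclideanSpace.single i 1))
        = fun y : EuclideanSpace ℝ (Fin d) => deriv H (‖y‖ ^ 2) *
          (2 * inner ℝ y (EuclideanSpace.single i 1)) :=
      funext fun y => fderiv_comp_norm_sq hH1 y _
    have h2 : HasFDerivAt (fun y : EuclideanSpace ℝ (Fin d) =>
        2 * inner ℝ y (EuclideanSpace.single i (1 : ℝ)))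
        ((2 : ℝ) • (innerSL ℝ (EuclideanSpace.single i (1 : ℝ)))) x := by
      have := ((innerSL ℝ (EuclideanSpace.single i (1 : ℝ))).hasFDerivAt (x := x)).const_mul 2
      refine this.congr_of_eventuallyEq (Eventually.of_forall fun y => ?_)
      simp only [innerSL_apply_apply, real_inner_comm]
    have h3 : DifferentiableAt ℝ (fun y : EuclideanSpace ℝ (Fin d) => deriv H (‖y‖ ^ 2)) x :=
      (hH2 _).comp x ((contDiff_norm_sq ℝ (n := 1)).differentiable one_ne_zero x)
    rw [h, fderiv_fun_mul h3 h2.differentiableAt, h2.fderiv]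
    simp [fderiv_comp_norm_sq hH2, EuclideanSpace.inner_single_right]
    ring
  rw [Finset.sum_congr rfl fun i _ => key i, Finset.sum_add_distrib, ← Finset.mul_sum,
    ← EuclideanSpace.real_norm_sq_eq]
  simp
  ring

theorem sum_fderiv_comp_norm_sq_mul_fderiv {d : ℕ} {H : ℝ → ℝ} (hH : Differentiable ℝ H)
    (g : EuclideanSpace ℝ (Fin d) → ℝ) (x : EuclideanSpace ℝ (Fin d)) :
    ∑ i, fderiv ℝ (fun y => H (‖y‖ ^ 2)) x (EuclideanSpace.single i 1)
      * fderiv ℝ g x (EuclideanSpace.single i 1) = 2 * deriv H (‖x‖ ^ 2) * fderiv ℝ g x x := by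
  have hx : x = ∑ i, x i • EuclideanSpace.single i (1 : ℝ) := by
    ext j
    simp [Pi.single_apply]
  conv_rhs => rw [hx, map_sum]
  rw [← hx, Finset.mul_sum]
  refine Finset.sum_congr rfl fun i _ => ?_
  rw [fderiv_comp_norm_sq hH, map_smul, EuclideanSpace.inner_single_right]
  simp
  ring

theorem integral_fderiv_eq_zero_of_hasCompactSupport {d : ℕ} {f : EuclideanSpace ℝ (Fin d) → ℝ}
    (hf : ContDiff ℝ 1 f) (hc : HasCompactSupport f) (v : EuclideanSpace ℝ (Fin d)) :
    ∫ x, fderiv ℝ f x v = 0 := by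
  have h1 : Integrable (fun x => fderiv ℝ f x v) :=
    ((hf.continuous_fderiv one_ne_zero).clm_apply continuous_const).integrable_of_hasCompactSupport
      (hc.fderiv_apply ℝ v)
  have h := integral_mul_fderiv_eq_neg_fderiv_mul_of_integrable (μ := volume)
    (f := fun _ : EuclideanSpace ℝ (Fin d) => (1 : ℝ)) (g := f) (v := v)
    (by simp) (by simpa using h1)
    (by simpa using hf.continuous.integrable_of_hasCompactSupport hc)
    (fun x _ => differentiableAt_const _) (fun x _ => hf.differentiable one_ne_zero x)
  simpa using h

/-- Green's second identity for a compactly supported factor. -/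
theorem integral_mul_laplacian_sub_eq_zero {d : ℕ} {U K : Set (EuclideanSpace ℝ (Fin d))}
    (hU : IsOpen U) (hK : IsCompact K) (hKU : K ⊆ U) {a u : EuclideanSpace ℝ (Fin d) → ℝ}
    (ha : ContDiffOn ℝ 2 a U) (hu : ContDiffOn ℝ 2 u U) (ha0 : ∀ x ∉ K, a x = 0) :
    ∫ x in U, (a x * laplacian u x - u x * laplacian a x) = 0 := by
  have haK : ∀ x ∉ K, a =ᶠ[𝓝 x] fun _ => 0 := fun x hx => by
    filter_upwards [hK.isClosed.isOpen_compl.mem_nhds hx] with y hy using ha0 y hy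
  set V : Fin d → EuclideanSpace ℝ (Fin d) → ℝ := fun i x =>
    a x * fderiv ℝ u x (EuclideanSpace.single i 1) - u x * fderiv ℝ a x (EuclideanSpace.single i 1)
    with hV
  have hV0 : ∀ i, ∀ x ∉ K, V i x = 0 := fun i x hx => by
    simp [hV, ha0 x hx, (haK x hx).fderiv_eq]
  have hVc : ∀ i, HasCompactSupport (V i) := fun i => HasCompactSupport.intro hK (hV0 i)
  have hVs : ∀ i, ContDiff ℝ 1 (V i) := fun i => contDiff_iff_contDiffAt.2 fun x => by
    by_cases hx : x ∈ K
    · have hax := ha.contDiffAt (hU.mem_nhds (hKU hx))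
      have hux := hu.contDiffAt (hU.mem_nhds (hKU hx))
      exact ((hax.of_le one_le_two).mul ((hux.fderiv_right le_rfl).clm_apply contDiffAt_const)).sub
        ((hux.of_le one_le_two).mul ((hax.fderiv_right le_rfl).clm_apply contDiffAt_const))
    · refine (contDiffAt_const (c := (0 : ℝ))).congr_of_eventuallyEq ?_
      filter_upwards [hK.isClosed.isOpen_compl.mem_nhds hx] with y hy using hV0 i y hy
  have hdiv : ∀ x, U.indicator (fun x => a x * laplacian u x - u x * laplacian a x) x
      = ∑ i, fderiv ℝ (V i) x (EuclideanSpace.single i 1) := fun x => by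
    by_cases hx : x ∈ U
    · have hax := ha.contDiffAt (hU.mem_nhds hx)
      have hux := hu.contDiffAt (hU.mem_nhds hx)
      have ha1 := hax.differentiableAt two_ne_zero
      have hu1 := hux.differentiableAt two_ne_zero
      rw [indicator_of_mem hx, laplacian_eq_sum_of_contDiffAt hax,
        laplacian_eq_sum_of_contDiffAt hux, Finset.mul_sum, Finset.mul_sum,
        ← Finset.sum_sub_distrib]
      refine Finset.sum_congr rfl fun i _ => ?_
      simp only [hV]
      rw [fderiv_fun_sub
        (ha1.fun_mul (hux.differentiableAt_fderiv.clm_apply (differentiableAt_const _)))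
        (hu1.fun_mul (hax.differentiableAt_fderiv.clm_apply (differentiableAt_const _))),
        sub_apply, fderiv_mul_fderiv_apply ha1 hux,
        fderiv_mul_fderiv_apply hu1 hax]
      ring
    · rw [indicator_of_notMem hx]
      refine (Finset.sum_eq_zero fun i _ => ?_).symm
      have : V i =ᶠ[𝓝 x] fun _ => 0 := by
        filter_upwards [hK.isClosed.isOpen_compl.mem_nhds fun h => hx (hKU h)] with y hy
          using hV0 i y hy
      simp [this.fderiv_eq]
  rw [← integral_indicator hU.measurableSet, integral_congr_ae (Eventually.of_forall hdiv),
    integral_finsetSum]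
  · exact Finset.sum_eq_zero fun i _ =>
      integral_fderiv_eq_zero_of_hasCompactSupport (hVs i) (hVc i) _
  · exact fun i _ => (((hVs i).continuous_fderiv one_ne_zero).clm_apply
      continuous_const).integrable_of_hasCompactSupport ((hVc i).fderiv_apply ℝ _)

theorem integral_mul_laplacian_sub_eq_zero_of_eqOn_diff {d : ℕ}
    {U K : Set (EuclideanSpace ℝ (Fin d))}
    (hU : IsOpen U) (hK : IsCompact K) (hKU : K ⊆ U) {a u : EuclideanSpace ℝ (Fin d) → ℝ}
    (ha : ContDiffOn ℝ 2 a U) (hu : ContDiffOn ℝ 2 u U) (ha0 : ∀ x ∈ U, x ∉ K → a x = 0) :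
    ∫ x in U, (a x * laplacian u x - u x * laplacian a x) = 0 := by
  have heq : EqOn (U.indicator a) a U := fun x hx => indicator_of_mem hx a
  rw [← integral_mul_laplacian_sub_eq_zero hU hK hKU (ha.congr heq) hu]
  · refine setIntegral_congr_fun hU.measurableSet fun x hx => ?_
    have h : U.indicator a =ᶠ[𝓝 x] a := heq.eventuallyEq_of_mem (hU.mem_nhds hx)
    simp only [laplacian_congr_of_eventuallyEq h, heq hx]
  · intro x hx
    by_cases hxU : x ∈ U
    · rw [heq hxU, ha0 x hxU hx]
    · exact indicator_of_notMem hxU a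

theorem ContDiffOn.laplacian {d : ℕ} {f : EuclideanSpace ℝ (Fin d) → ℝ}
    {U : Set (EuclideanSpace ℝ (Fin d))} {m n : WithTop ℕ∞} (hf : ContDiffOn ℝ n f U)
    (hU : IsOpen U) (hmn : m + 2 ≤ n) : ContDiffOn ℝ m (laplacian f) U := by
  have h2 : ContDiffOn ℝ m (fderiv ℝ (fderiv ℝ f)) U :=
    (hf.fderiv_of_isOpen (m := m + 1) hU (by rwa [add_assoc, one_add_one_eq_two])).fderiv_of_isOpen
      hU le_rfl
  have h : _root_.laplacian f = fun x => ∑ i, fderiv ℝ (fderiv ℝ f) x (EuclideanSpace.single i 1)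
      (EuclideanSpace.single i 1) := funext (laplacian_eq_sum_fderiv_fderiv f)
  rw [h]
  exact ContDiffOn.sum fun i _ => (h2.clm_apply contDiffOn_const).clm_apply contDiffOn_const

theorem ContDiffOn.continuousOn_laplacian {d : ℕ} {f : EuclideanSpace ℝ (Fin d) → ℝ}
    {U : Set (EuclideanSpace ℝ (Fin d))} (hf : ContDiffOn ℝ 2 f U)
    (hU : IsOpen U) : ContinuousOn (_root_.laplacian f) U :=
  (hf.laplacian (m := 0) hU (by simp)).continuousOn

section Annulus

variable {d : ℕ} {a b : ℝ}

theorem isOpen_annulus : IsOpen (annulus d a b) :=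
  (isOpen_lt continuous_const continuous_norm).inter (isOpen_lt continuous_norm continuous_const)

theorem isClosed_closedAnnulus : IsClosed (closedAnnulus d a b) :=
  (isClosed_le continuous_const continuous_norm).inter
    (isClosed_le continuous_norm continuous_const)

theorem isCompact_closedAnnulus : IsCompact (closedAnnulus d a b) :=
  (isCompact_closedBall 0 b).of_isClosed_subset isClosed_closedAnnulus
    fun x hx => by simpa using hx.2

theorem annulus_subset_closedAnnulus : annulus d a b ⊆ closedAnnulus d a b :=
  fun _ hx => ⟨hx.1.le, hx.2.le⟩

theorem closedAnnulus_mem_nhds {x : EuclideanSpace ℝ (Fin d)} (hx : x ∈ annulus d a b) :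
    closedAnnulus d a b ∈ 𝓝 x :=
  mem_of_superset (isOpen_annulus.mem_nhds hx) annulus_subset_closedAnnulus

theorem volume_annulus_lt_top : volume (annulus d a b) < ⊤ :=
  (measure_mono annulus_subset_closedAnnulus).trans_lt isCompact_closedAnnulus.measure_lt_top

theorem integrableOn_annulus {f : EuclideanSpace ℝ (Fin d) → ℝ}
    (hf : ContinuousOn f (annulus d a b)) {L : ℝ} (hL : ∀ x ∈ annulus d a b, |f x| ≤ L) :
    IntegrableOn f (annulus d a b) :=
  IntegrableOn.of_bound volume_annulus_lt_top
    (hf.aestronglyMeasurable isOpen_annulus.measurableSet) L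
    ((ae_restrict_iff' isOpen_annulus.measurableSet).2 (Eventually.of_forall hL))

theorem uniqueDiffOn_closedAnnulus (ha : 0 < a) (hab : a < b) :
    UniqueDiffOn ℝ (closedAnnulus d a b) := by
  intro x hx
  have hx0 : 0 < ‖x‖ := ha.trans_le hx.1
  set c : EuclideanSpace ℝ (Fin d) := ((a + b) / 2 / ‖x‖) • x
  have hc : ‖c‖ = (a + b) / 2 := by
    rw [norm_smul, Real.norm_of_nonneg (by have := ha.trans hab; positivity),
      div_mul_cancel₀ _ hx0.ne']
  have hsub : closedBall c ((b - a) / 2) ⊆ closedAnnulus d a b := by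
    intro y hy
    rw [mem_closedBall, dist_eq_norm] at hy
    have h1 := norm_sub_norm_le c y
    have h2 := norm_sub_norm_le y c
    rw [norm_sub_rev] at h1
    exact ⟨by linarith, by linarith⟩
  have hxc : x ∈ closedBall c ((b - a) / 2) := by
    have : x - c = (1 - (a + b) / 2 / ‖x‖) • x := by rw [sub_smul, one_smul]
    rw [mem_closedBall, dist_eq_norm, this, norm_smul, Real.norm_eq_abs, ← abs_of_pos hx0,
      ← abs_mul, abs_of_pos hx0, sub_mul, div_mul_cancel₀ _ hx0.ne', abs_le]
    constructor <;> linarith [hx.1, hx.2]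
  refine UniqueDiffWithinAt.mono (uniqueDiffOn_convex (convex_closedBall c _) ?_ x hxc) hsub
  exact ⟨c, ball_subset_interior_closedBall (mem_ball_self (by linarith))⟩

theorem exists_volume_closedAnnulus_le (ha : 0 < a) (b : ℝ) :
    ∃ C, 0 ≤ C ∧ ∀ s t, a ≤ s → s ≤ t → t ≤ b →
      volume.real (closedAnnulus d s t) ≤ C * (t - s) := by
  refine ⟨d * |b| ^ (d - 1) * volume.real (ball (0 : EuclideanSpace ℝ (Fin d)) 1), by positivity,
    fun s t hs hst ht => ?_⟩
  have hs0 : 0 < s := ha.trans_le hs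
  have h : closedAnnulus d s t = closedBall 0 t \ ball 0 s := by
    ext x
    simp [closedAnnulus, and_comm]
  have hpow : t ^ d - s ^ d ≤ (t - s) * d * |b| ^ (d - 1) := by
    refine (le_abs_self _).trans ((abs_pow_sub_pow_le _ _ _).trans ?_)
    rw [abs_of_nonneg (sub_nonneg.2 hst), abs_of_pos hs0, abs_of_pos (hs0.trans_le hst),
      max_eq_left hst]
    have := hs0.le.trans hst
    have : 0 ≤ t - s := sub_nonneg.2 hst
    gcongr
    exact ht.trans (le_abs_self b)
  have hball : volume.real (ball (0 : EuclideanSpace ℝ (Fin d)) s)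
      = s ^ d * volume.real (ball (0 : EuclideanSpace ℝ (Fin d)) 1) := by
    simp [measureReal_def, Measure.addHaar_ball_of_pos _ _ hs0, ENNReal.toReal_ofReal, hs0.le]
  have hω : 0 ≤ volume.real (ball (0 : EuclideanSpace ℝ (Fin d)) 1) := measureReal_nonneg
  rw [h, measureReal_sdiff ((ball_subset_ball hst).trans ball_subset_closedBall)
    measurableSet_ball measure_closedBall_lt_top.ne,
    Measure.addHaar_real_closedBall _ _ (hs0.le.trans hst), hball, finrank_euclideanSpace_fin,
    ← sub_mul]
  calc _ ≤ (t - s) * d * |b| ^ (d - 1) * volume.real (ball (0 : EuclideanSpace ℝ (Fin d)) 1) := by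
        gcongr
    _ = _ := by ring

/-- The boundary layer of width `ε`, measured by the defining function
`(|x|² - a²)(b² - |x|²)`, has volume `O(ε)`. -/
theorem exists_volume_boundaryLayer_le (ha : 0 < a) (hab : a < b) :
    ∃ C, 0 ≤ C ∧ ∀ ε, 0 < ε → volume.real {x | x ∈ annulus d a b ∧
      (‖x‖ ^ 2 - a ^ 2) * (b ^ 2 - ‖x‖ ^ 2) ≤ 2 * ε} ≤ C * ε := by
  obtain ⟨C, hC0, hC⟩ := exists_volume_closedAnnulus_le (d := d) ha b
  have hba : 0 < b - a := sub_pos.2 hab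
  refine ⟨C * (4 / (a ^ 2 * (b - a))) * 2, by positivity, fun ε hε => ?_⟩
  set h : ℝ := 4 * ε / (a ^ 2 * (b - a)) with hh
  have hh0 : 0 < h := by positivity
  have hh1 : h * (a ^ 2 * (b - a)) = 4 * ε := div_mul_cancel₀ _ (by positivity)
  have hsub : {x | x ∈ annulus d a b ∧ (‖x‖ ^ 2 - a ^ 2) * (b ^ 2 - ‖x‖ ^ 2) ≤ 2 * ε}
      ⊆ closedAnnulus d a (min (a + h) b) ∪ closedAnnulus d (max (b - h) a) b := by
    rintro x ⟨⟨hx1, hx2⟩, hx3⟩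
    by_contra hx
    simp only [closedAnnulus, mem_union, mem_ofPred_eq, not_or, not_and, not_le, le_min_iff,
      max_le_iff, and_imp] at hx
    have h1 : a + h < ‖x‖ := by
      by_contra hc
      have := hx.1 hx1.le (not_lt.1 hc)
      linarith
    have h2 : ‖x‖ < b - h := by
      by_contra hc
      have := hx.2 (not_lt.1 hc) hx1.le
      linarith
    have h3 : h * (b - a) / 2 < (‖x‖ - a) * (b - ‖x‖) := by nlinarith
    have h4 : a ^ 2 ≤ (‖x‖ + a) * (b + ‖x‖) := by nlinarith
    have h5 : (‖x‖ ^ 2 - a ^ 2) * (b ^ 2 - ‖x‖ ^ 2)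
        = ((‖x‖ - a) * (b - ‖x‖)) * ((‖x‖ + a) * (b + ‖x‖)) := by ring
    have h6 : h * (b - a) / 2 * a ^ 2 < ((‖x‖ - a) * (b - ‖x‖)) * ((‖x‖ + a) * (b + ‖x‖)) :=
      mul_lt_mul h3 h4 (by positivity) (by nlinarith)
    nlinarith
  have hfin : volume (closedAnnulus d a (min (a + h) b) ∪ closedAnnulus d (max (b - h) a) b) ≠ ⊤ :=
    (isCompact_closedAnnulus.union isCompact_closedAnnulus).measure_lt_top.ne
  calc _ ≤ _ := measureReal_mono hsub hfin
    _ ≤ _ := measureReal_union_le _ _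
    _ ≤ C * (min (a + h) b - a) + C * (b - max (b - h) a) :=
      add_le_add (hC _ _ le_rfl (le_min (by linarith) hab.le) (min_le_right _ _))
        (hC _ _ (le_max_right _ _) (max_le (by linarith) hab.le) le_rfl)
    _ ≤ C * h + C * h := by
      gcongr
      · linarith [min_le_left (a + h) b]
      · linarith [le_max_left (b - h) a]
    _ = _ := by rw [hh]; ring

end Annulus

theorem exists_smooth_step : ∃ θ : ℝ → ℝ, ∃ T : ℝ, ContDiff ℝ 2 θ ∧ (∀ u ≤ 1, θ u = 0) ∧
    (∀ u, 2 ≤ u → θ u = 1) ∧ (∀ u, 0 ≤ θ u ∧ θ u ≤ 1) ∧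
    (∀ u, |deriv θ u| ≤ T ∧ |deriv (deriv θ) u| ≤ T) := by
  have hθ : ContDiff ℝ 2 fun u => Real.smoothTransition (u - 1) :=
    Real.smoothTransition.contDiff.comp (contDiff_id.sub contDiff_const)
  set θ : ℝ → ℝ := fun u => Real.smoothTransition (u - 1)
  have h0 : ∀ u ≤ 1, θ u = 0 := fun u hu => Real.smoothTransition.zero_of_nonpos (by linarith)
  have h1 : ∀ u, 2 ≤ u → θ u = 1 := fun u hu => Real.smoothTransition.one_of_one_le (by linarith)
  have hd1 : ContDiff ℝ 1 (deriv θ) := ((contDiff_succ_iff_deriv (n := 1)).1 hθ).2.2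
  have hsupp : HasCompactSupport (deriv θ) := by
    refine HasCompactSupport.intro (isCompact_Icc (a := (1 : ℝ)) (b := 2)) fun u hu => ?_
    rw [mem_Icc, not_and_or, not_le, not_le] at hu
    rcases hu with hu | hu
    · have : θ =ᶠ[𝓝 u] fun _ => 0 := by
        filter_upwards [Iio_mem_nhds hu] with v hv using h0 v (le_of_lt hv)
      simp [this.deriv_eq]
    · have : θ =ᶠ[𝓝 u] fun _ => 1 := by
        filter_upwards [Ioi_mem_nhds hu] with v hv using h1 v (le_of_lt hv)
      simp [this.deriv_eq]
  obtain ⟨T1, hT1⟩ := hd1.continuous.bounded_above_of_compact_support hsupp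
  obtain ⟨T2, hT2⟩ := (hd1.continuous_deriv le_rfl).bounded_above_of_compact_support hsupp.deriv
  exact ⟨θ, max T1 T2, hθ, h0, h1,
    fun u => ⟨Real.smoothTransition.nonneg _, Real.smoothTransition.le_one _⟩,
    fun u => ⟨(hT1 u).trans (le_max_left _ _), (hT2 u).trans (le_max_right _ _)⟩⟩

/-- Cutoff functions of `t = |x|²` vanishing near the boundary of `[α, β]`. -/
theorem exists_cutoff (α β : ℝ) : ∃ B : ℝ, 0 ≤ B ∧ ∀ ε, 0 < ε → ε < 1 → ∃ H : ℝ → ℝ,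
    ContDiff ℝ 2 H ∧ (∀ t, (t - α) * (β - t) ≤ ε → H t = 0) ∧
    (∀ t, 2 * ε ≤ (t - α) * (β - t) → H t = 1) ∧ (∀ t, 0 ≤ H t ∧ H t ≤ 1) ∧
    (∀ t ∈ Icc α β, |deriv H t| ≤ B / ε ∧ |deriv (deriv H) t| ≤ B / ε ^ 2) ∧
    (∀ t, 2 * ε < (t - α) * (β - t) → deriv H t = 0 ∧ deriv (deriv H) t = 0) := by
  obtain ⟨θ, T, hθ, h0, h1, h01, hT⟩ := exists_smooth_step
  have hT0 : 0 ≤ T := (abs_nonneg _).trans (hT 0).1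
  refine ⟨T * (1 + |β - α|) ^ 2 + 2 * T, by positivity, fun ε hε hε1 => ?_⟩
  have hp : ∀ t, HasDerivAt (fun t => (t - α) * (β - t) / ε) ((α + β - 2 * t) / ε) t := fun t => by
    convert! (((hasDerivAt_id t).sub_const α).mul ((hasDerivAt_id t).const_sub β)).div_const ε
      using 2
    simp
    ring
  have hp2 : ∀ t, HasDerivAt (fun t : ℝ => (α + β - 2 * t) / ε) (-2 / ε) t := fun t => by
    convert! (((hasDerivAt_id t).const_mul 2).const_sub (α + β)).div_const ε using 2
    simp
  have hθ1 : Differentiable ℝ θ := hθ.differentiable two_ne_zero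
  have hθ2 : Differentiable ℝ (deriv θ) :=
    ((contDiff_succ_iff_deriv (n := 1)).1 hθ).2.2.differentiable one_ne_zero
  have hd : deriv (fun t => θ ((t - α) * (β - t) / ε))
      = fun t => deriv θ ((t - α) * (β - t) / ε) * ((α + β - 2 * t) / ε) :=
    funext fun t => ((hθ1 _).hasDerivAt.comp t (hp t)).deriv
  have hdd : ∀ t, deriv (deriv fun t => θ ((t - α) * (β - t) / ε)) t
      = deriv (deriv θ) ((t - α) * (β - t) / ε) * ((α + β - 2 * t) / ε) * ((α + β - 2 * t) / ε)
        + deriv θ ((t - α) * (β - t) / ε) * (-2 / ε) := fun t => by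
    rw [hd]
    exact (((hθ2 _).hasDerivAt.comp t (hp t)).mul (hp2 t)).deriv
  refine ⟨fun t => θ ((t - α) * (β - t) / ε), hθ.comp (by fun_prop),
    fun t ht => h0 _ ((div_le_one hε).2 ht), fun t ht => h1 _ ((le_div_iff₀ hε).2 ht),
    fun t => h01 _, fun t ht => ?_, fun t ht => ?_⟩
  · have hq : |(α + β - 2 * t) / ε| ≤ (1 + |β - α|) / ε := by
      rw [abs_div, abs_of_pos hε]
      gcongr
      rw [abs_of_nonneg (by linarith [ht.1, ht.2] : 0 ≤ β - α), abs_le]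
      constructor <;> linarith [ht.1, ht.2]
    have hT' := hT ((t - α) * (β - t) / ε)
    have hεinv : 1 ≤ 1 / ε := (one_le_div hε).2 hε1.le
    constructor
    · rw [hd, abs_mul]
      calc _ ≤ T * ((1 + |β - α|) / ε) := by
            gcongr
            exact hT'.1
        _ ≤ _ := by
          rw [← mul_div_assoc]
          gcongr
          nlinarith [abs_nonneg (β - α), mul_nonneg hT0 (abs_nonneg (β - α)),
            mul_nonneg hT0 (sq_nonneg (|β - α|))]
    · rw [hdd]
      refine (abs_add_le _ _).trans ?_
      rw [abs_mul, abs_mul, abs_mul]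
      calc _ ≤ T * ((1 + |β - α|) / ε) * ((1 + |β - α|) / ε) + T * (2 / ε * (1 / ε)) := by
            gcongr
            · exact hT'.2
            · exact hT'.1
            · rw [abs_div, abs_neg, abs_two, abs_of_pos hε]
              exact le_mul_of_one_le_right (by positivity) hεinv
        _ = _ := by field_simp
  · have : 2 < (t - α) * (β - t) / ε := (lt_div_iff₀ hε).2 ht
    have hc : θ =ᶠ[𝓝 ((t - α) * (β - t) / ε)] fun _ => 1 := by
      filter_upwards [Ioi_mem_nhds this] with v hv using h1 v (le_of_lt hv)
    have hz : deriv θ ((t - α) * (β - t) / ε) = 0 := by simp [hc.deriv_eq]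
    have hz2 : deriv (deriv θ) ((t - α) * (β - t) / ε) = 0 := by simp [hc.deriv.deriv_eq]
    exact ⟨by rw [hd]; simp [hz], by rw [hdd]; simp [hz, hz2]⟩

section Green

variable {d : ℕ} {a b : ℝ} {G : EuclideanSpace ℝ (Fin d) → ℝ}

theorem norm_sq_sub_mul_pos (ha : 0 < a) {x : EuclideanSpace ℝ (Fin d)} (hx : x ∈ annulus d a b) :
    0 < (‖x‖ ^ 2 - a ^ 2) * (b ^ 2 - ‖x‖ ^ 2) :=
  mul_pos (sub_pos.2 (pow_lt_pow_left₀ hx.1 ha.le two_ne_zero))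
    (sub_pos.2 (pow_lt_pow_left₀ hx.2 (norm_nonneg x) two_ne_zero))

theorem isCompact_inner_region (ε : ℝ) : IsCompact {x | x ∈ closedAnnulus d a b ∧
    ε ≤ (‖x‖ ^ 2 - a ^ 2) * (b ^ 2 - ‖x‖ ^ 2)} :=
  isCompact_closedAnnulus.of_isClosed_subset
    (isClosed_closedAnnulus.inter (isClosed_le continuous_const
      (g := fun x : EuclideanSpace ℝ (Fin d) => (‖x‖ ^ 2 - a ^ 2) * (b ^ 2 - ‖x‖ ^ 2))
      (by fun_prop))) fun _ hx => hx.1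

theorem inner_region_subset_annulus {ε : ℝ} (hε : 0 < ε) : {x | x ∈ closedAnnulus d a b ∧
    ε ≤ (‖x‖ ^ 2 - a ^ 2) * (b ^ 2 - ‖x‖ ^ 2)} ⊆ annulus d a b := by
  rintro x ⟨hx, hx'⟩
  refine ⟨hx.1.lt_of_ne ?_, hx.2.lt_of_ne ?_⟩ <;> rintro h
  · rw [h] at hx'
    linarith
  · rw [h] at hx'
    linarith

/-- The commutator term produced by cutting off `G` in Green's second identity is controlled by the
vanishing order of `G` at the boundary of the annulus. -/
theorem exists_cutoff_green_bound (ha : 0 < a) (hab : a < b)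
    (hG : ContDiffOn ℝ 2 G (annulus d a b)) {K L : ℝ} {k : ℕ} (hK : 0 ≤ K)
    (hG0 : ∀ x ∈ annulus d a b, |G x| ≤ K * ((‖x‖ ^ 2 - a ^ 2) * (b ^ 2 - ‖x‖ ^ 2)) ^ (k + 1))
    (hG1 : ∀ x ∈ annulus d a b,
      |fderiv ℝ G x x| ≤ K * ((‖x‖ ^ 2 - a ^ 2) * (b ^ 2 - ‖x‖ ^ 2)) ^ k)
    (hG2 : ∀ x ∈ annulus d a b, |laplacian G x| ≤ L) :
    ∃ C, 0 ≤ C ∧ ∀ ε, 0 < ε → ε < 1 → ∃ H : ℝ → ℝ, Continuous H ∧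
      (∀ t, 2 * ε ≤ (t - a ^ 2) * (b ^ 2 - t) → H t = 1) ∧ (∀ t, 0 ≤ H t ∧ H t ≤ 1) ∧
      ∀ (u : EuclideanSpace ℝ (Fin d) → ℝ) (M L' : ℝ), ContDiffOn ℝ 2 u (annulus d a b) →
        (∀ x ∈ annulus d a b, |u x| ≤ M) → (∀ x ∈ annulus d a b, |laplacian u x| ≤ L') → 0 ≤ M →
        |∫ x in annulus d a b, H (‖x‖ ^ 2) * (G x * laplacian u x - u x * laplacian G x)|
          ≤ C * M * ε ^ k := by
  obtain ⟨B, hB, hcut⟩ := exists_cutoff (a ^ 2) (b ^ 2)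
  obtain ⟨Cv, hCv, hvol⟩ := exists_volume_boundaryLayer_le (d := d) ha hab
  set A := annulus d a b with hA
  have hAo : IsOpen A := isOpen_annulus
  set P : EuclideanSpace ℝ (Fin d) → ℝ := fun x => (‖x‖ ^ 2 - a ^ 2) * (b ^ 2 - ‖x‖ ^ 2) with hP
  have hPc : Continuous P := by fun_prop
  set C1 : ℝ := B * K * 2 ^ k * (4 + 2 * (4 * b ^ 2 + 2 * d)) with hC1
  have hC10 : 0 ≤ C1 := by positivity
  refine ⟨C1 * Cv, by positivity, fun ε hε hε1 => ?_⟩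
  obtain ⟨H, hH, hH0, hH1, hH01, hHd, hHz⟩ := hcut ε hε hε1
  refine ⟨H, hH.continuous, hH1, hH01, fun u M L' hu huM huL hM => ?_⟩
  have hH' : Differentiable ℝ H := hH.differentiable two_ne_zero
  have hη : ContDiff ℝ 2 fun x : EuclideanSpace ℝ (Fin d) => H (‖x‖ ^ 2) :=
    hH.comp (contDiff_norm_sq ℝ)
  have hηG : ContDiffOn ℝ 2 (fun x => H (‖x‖ ^ 2) * G x) A := hη.contDiffOn.mul hG
  have hgreen := integral_mul_laplacian_sub_eq_zero_of_eqOn_diff hAo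
    (isCompact_inner_region (d := d) (a := a) (b := b) ε) (inner_region_subset_annulus hε) hηG hu
    (fun x hx hxK => by
      have : (‖x‖ ^ 2 - a ^ 2) * (b ^ 2 - ‖x‖ ^ 2) ≤ ε := by
        by_contra hc
        exact hxK ⟨annulus_subset_closedAnnulus hx, (not_le.1 hc).le⟩
      simp [hH0 _ this])
  set E : EuclideanSpace ℝ (Fin d) → ℝ := fun x =>
    2 * (2 * deriv H (‖x‖ ^ 2) * fderiv ℝ G x x) + G x *
      (4 * ‖x‖ ^ 2 * deriv (deriv H) (‖x‖ ^ 2) + 2 * d * deriv H (‖x‖ ^ 2)) with hE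
  have hsplit : ∀ x ∈ A, H (‖x‖ ^ 2) * (G x * laplacian u x - u x * laplacian G x)
      - (H (‖x‖ ^ 2) * G x * laplacian u x - u x * laplacian (fun x => H (‖x‖ ^ 2) * G x) x)
      = u x * E x := fun x hx => by
    rw [laplacian_mul hη.contDiffAt (hG.contDiffAt (hAo.mem_nhds hx)),
      sum_fderiv_comp_norm_sq_mul_fderiv hH', laplacian_comp_norm_sq hH]
    ring
  have hE0 : ∀ x ∈ A, 2 * ε < P x → u x * E x = 0 := fun x hx hx' => by
    simp [hE, hHz _ hx']
  have hEb : ∀ x ∈ A, P x ≤ 2 * ε → |u x * E x| ≤ M * (C1 * ε ^ k / ε) := fun x hx hx' => by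
    have hPx : 0 < P x := norm_sq_sub_mul_pos ha hx
    have hmem : ‖x‖ ^ 2 ∈ Icc (a ^ 2) (b ^ 2) :=
      ⟨pow_le_pow_left₀ ha.le hx.1.le 2, pow_le_pow_left₀ (norm_nonneg x) hx.2.le 2⟩
    have hd := hHd _ hmem
    rw [abs_mul]
    refine mul_le_mul (huM x hx) ?_ (abs_nonneg _) hM
    have e1 : |fderiv ℝ G x x| ≤ K * (2 * ε) ^ k :=
      (hG1 x hx).trans (mul_le_mul_of_nonneg_left (pow_le_pow_left₀ hPx.le hx' k) hK)
    have e0 : |G x| ≤ K * (2 * ε) ^ (k + 1) :=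
      (hG0 x hx).trans (mul_le_mul_of_nonneg_left (pow_le_pow_left₀ hPx.le hx' _) hK)
    have e2 : |4 * ‖x‖ ^ 2 * deriv (deriv H) (‖x‖ ^ 2) + 2 * d * deriv H (‖x‖ ^ 2)|
        ≤ (4 * b ^ 2 + 2 * d) * (B / ε ^ 2) := by
      refine (abs_add_le _ _).trans ?_
      rw [abs_mul, abs_mul (2 * (d : ℝ)), abs_of_nonneg (by positivity : 0 ≤ 4 * ‖x‖ ^ 2),
        abs_of_nonneg (by positivity : 0 ≤ 2 * (d : ℝ)), add_mul]
      refine add_le_add (mul_le_mul (by linarith [hmem.2]) hd.2 (abs_nonneg _) (by positivity))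
        (mul_le_mul_of_nonneg_left (hd.1.trans ?_) (by positivity))
      exact div_le_div_of_nonneg_left hB (by positivity) (by nlinarith)
    calc |E x| ≤ 2 * (2 * (B / ε) * (K * (2 * ε) ^ k))
          + K * (2 * ε) ^ (k + 1) * ((4 * b ^ 2 + 2 * d) * (B / ε ^ 2)) := by
          refine (abs_add_le _ _).trans ?_
          rw [abs_mul, abs_mul, abs_mul, abs_mul, abs_two]
          gcongr
          exact hd.1
      _ = C1 * ε ^ k / ε := by
          rw [hC1, mul_pow, mul_pow]
          field_simp
          ring
  have hEint : IntegrableOn (fun x => u x * E x) A := by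
    refine integrableOn_annulus (L := M * (C1 * ε ^ k / ε)) ?_ fun x hx => ?_
    · refine ContinuousOn.congr ?_ fun x hx => (hsplit x hx).symm
      exact (hη.continuous.continuousOn.mul ((hG.continuousOn.mul (hu.continuousOn_laplacian
        hAo)).sub (hu.continuousOn.mul (hG.continuousOn_laplacian hAo)))).sub
        ((hηG.continuousOn.mul (hu.continuousOn_laplacian hAo)).sub
          (hu.continuousOn.mul (hηG.continuousOn_laplacian hAo)))
    · by_cases h : P x ≤ 2 * ε
      · exact hEb x hx h
      · rw [hE0 x hx (not_le.1 h), abs_zero]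
        positivity
  have hGb : ∀ x ∈ A, |G x| ≤ K * (b ^ 2 * b ^ 2) ^ (k + 1) := fun x hx => by
    refine (hG0 x hx).trans ?_
    have h1 : a ^ 2 < ‖x‖ ^ 2 := pow_lt_pow_left₀ hx.1 ha.le two_ne_zero
    have h2 : ‖x‖ ^ 2 < b ^ 2 := pow_lt_pow_left₀ hx.2 (norm_nonneg x) two_ne_zero
    have h3 : 0 ≤ b ^ 2 - ‖x‖ ^ 2 := by linarith
    have h4 : 0 ≤ ‖x‖ ^ 2 - a ^ 2 := by linarith
    gcongr
    · nlinarith [sq_nonneg a]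
    · nlinarith [sq_nonneg ‖x‖]
  have hint : IntegrableOn
      (fun x => H (‖x‖ ^ 2) * (G x * laplacian u x - u x * laplacian G x)) A := by
    refine integrableOn_annulus (L := K * (b ^ 2 * b ^ 2) ^ (k + 1) * L' + M * L)
      (hη.continuous.continuousOn.mul ((hG.continuousOn.mul (hu.continuousOn_laplacian
        hAo)).sub (hu.continuousOn.mul (hG.continuousOn_laplacian hAo)))) fun x hx => ?_
    rw [abs_mul, abs_of_nonneg (hH01 _).1]
    refine (mul_le_of_le_one_left (abs_nonneg _) (hH01 _).2).trans ((abs_sub _ _).trans ?_)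
    rw [abs_mul, abs_mul]
    exact add_le_add (mul_le_mul (hGb x hx) (huL x hx) (abs_nonneg _) (by positivity))
      (mul_le_mul (huM x hx) (hG2 x hx) (abs_nonneg _) hM)
  have hval : ∫ x in A, H (‖x‖ ^ 2) * (G x * laplacian u x - u x * laplacian G x)
      = ∫ x in A, u x * E x := by
    rw [← sub_eq_zero, ← integral_sub hint hEint, ← hgreen]
    refine setIntegral_congr_fun hAo.measurableSet fun x hx => ?_
    simp only [← hsplit x hx]
    ring
  rw [hval]
  have hlayer : ∫ x in A, u x * E x = ∫ x in {x | x ∈ A ∧ P x ≤ 2 * ε}, u x * E x :=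
    setIntegral_eq_of_subset_of_forall_sdiff_eq_zero hAo.measurableSet (fun x hx => hx.1)
      fun x hx => hE0 x hx.1 (not_le.1 fun h => hx.2 ⟨hx.1, h⟩)
  rw [hlayer, ← Real.norm_eq_abs]
  calc _ ≤ M * (C1 * ε ^ k / ε) * volume.real {x | x ∈ A ∧ P x ≤ 2 * ε} :=
        norm_setIntegral_le_of_norm_le_const
          ((measure_mono fun x hx => hx.1).trans_lt volume_annulus_lt_top)
          fun x hx => hEb x hx.1 hx.2
    _ ≤ M * (C1 * ε ^ k / ε) * (Cv * ε) := by
        gcongr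
        exact hvol ε hε
    _ = C1 * Cv * M * ε ^ k := by field_simp

theorem exists_abs_integral_green_le (ha : 0 < a) (hab : a < b)
    (hG : ContDiffOn ℝ 2 G (annulus d a b)) {K L : ℝ} {k : ℕ} (hK : 0 ≤ K)
    (hG0 : ∀ x ∈ annulus d a b, |G x| ≤ K * ((‖x‖ ^ 2 - a ^ 2) * (b ^ 2 - ‖x‖ ^ 2)) ^ (k + 1))
    (hG1 : ∀ x ∈ annulus d a b,
      |fderiv ℝ G x x| ≤ K * ((‖x‖ ^ 2 - a ^ 2) * (b ^ 2 - ‖x‖ ^ 2)) ^ k)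
    (hG2 : ∀ x ∈ annulus d a b, |laplacian G x| ≤ L) :
    ∃ C, 0 ≤ C ∧ ∀ (u : EuclideanSpace ℝ (Fin d) → ℝ) (M L' : ℝ),
      ContDiffOn ℝ 2 u (annulus d a b) →
      (∀ x ∈ annulus d a b, |u x| ≤ M) → (∀ x ∈ annulus d a b, |laplacian u x| ≤ L') → 0 ≤ M →
      IntegrableOn (fun x => G x * laplacian u x - u x * laplacian G x) (annulus d a b) →
      |∫ x in annulus d a b, (G x * laplacian u x - u x * laplacian G x)| ≤ C * M * 0 ^ k := by
  obtain ⟨C, hC, hcut⟩ := exists_cutoff_green_bound ha hab hG hK hG0 hG1 hG2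
  refine ⟨C, hC, fun u M L' hu huM huL hM hint => ?_⟩
  set ε : ℕ → ℝ := fun m => 1 / ((m : ℝ) + 1 + 1) with hεdef
  have hε0 : ∀ m, 0 < ε m := fun m => by positivity
  have hε1 : ∀ m, ε m < 1 := fun m => by
    rw [hεdef, div_lt_one (by positivity)]
    have : (0 : ℝ) ≤ m := m.cast_nonneg
    linarith
  have hεt : Tendsto ε atTop (𝓝 0) := by
    have := (tendsto_one_div_add_atTop_nhds_zero_nat (𝕜 := ℝ)).comp (tendsto_add_atTop_nat 1)
    refine this.congr fun m => ?_
    simp [hεdef]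
  choose H hHc hH1 hH01 hHb using fun m => hcut (ε m) (hε0 m) (hε1 m)
  have hlim : Tendsto (fun m => ∫ x in annulus d a b,
      H m (‖x‖ ^ 2) * (G x * laplacian u x - u x * laplacian G x)) atTop
      (𝓝 (∫ x in annulus d a b, (G x * laplacian u x - u x * laplacian G x))) := by
    refine tendsto_integral_of_dominated_convergence
      (fun x => |G x * laplacian u x - u x * laplacian G x|) (fun m => ?_) hint.abs
      (fun m => Eventually.of_forall fun x => ?_) ?_
    · exact ((hHc m).comp (by fun_prop : Continuous fun x : EuclideanSpace ℝ (Fin d) =>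
        ‖x‖ ^ 2)).aestronglyMeasurable.mul hint.aestronglyMeasurable
    · rw [Real.norm_eq_abs, abs_mul, abs_of_nonneg (hH01 m _).1]
      exact mul_le_of_le_one_left (abs_nonneg _) (hH01 m _).2
    · refine (ae_restrict_iff' isOpen_annulus.measurableSet).2 (Eventually.of_forall fun x hx => ?_)
      have hev : ∀ᶠ m in atTop, 2 * ε m < (‖x‖ ^ 2 - a ^ 2) * (b ^ 2 - ‖x‖ ^ 2) :=
        (hεt.const_mul 2).eventually_lt_const (by simpa using norm_sq_sub_mul_pos ha hx)
      refine tendsto_const_nhds.congr' ?_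
      filter_upwards [hev] with m hm
      rw [hH1 m _ hm.le, one_mul]
  exact le_of_tendsto_of_tendsto' hlim.abs ((hεt.pow k).const_mul (C * M))
    fun m => hHb m u M L' hu huM huL hM

end Green

section ClosedAnnulus

variable {d : ℕ} {a b : ℝ}

theorem abs_le_of_radial_deriv_le (ha : 0 < a) {f : EuclideanSpace ℝ (Fin d) → ℝ}
    (hf : DifferentiableOn ℝ f (closedAnnulus d a b)) {x : EuclideanSpace ℝ (Fin d)}
    (hx : x ∈ closedAnnulus d a b) {s B : ℝ} (hs : s ∈ Icc a b)
    (hB : ∀ y ∈ closedAnnulus d a b, ‖y‖ ∈ uIcc s ‖x‖ →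
      |fderivWithin ℝ f (closedAnnulus d a b) y y| ≤ B)
    (h0 : ∀ y, ‖y‖ = s → f y = 0) : |f x| ≤ B / a * |‖x‖ - s| := by
  have hx0 : 0 < ‖x‖ := ha.trans_le hx.1
  set ω : EuclideanSpace ℝ (Fin d) := ‖x‖⁻¹ • x with hω
  have hωn : ‖ω‖ = 1 := by
    rw [hω, norm_smul, norm_inv, norm_norm, inv_mul_cancel₀ hx0.ne']
  have hsub : uIcc s ‖x‖ ⊆ Icc a b := uIcc_subset_Icc hs hx
  have hnorm : ∀ ρ ∈ uIcc s ‖x‖, ‖ρ • ω‖ = ρ := fun ρ hρ => by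
    rw [norm_smul, hωn, mul_one, Real.norm_of_nonneg (ha.le.trans (hsub hρ).1)]
  have hmem : ∀ ρ ∈ uIcc s ‖x‖, ρ • ω ∈ closedAnnulus d a b := fun ρ hρ => by
    rw [closedAnnulus, mem_ofPred_eq, hnorm ρ hρ]
    exact hsub hρ
  have hderiv : ∀ ρ ∈ uIcc s ‖x‖, HasDerivWithinAt (fun ρ : ℝ => f (ρ • ω))
      (fderivWithin ℝ f (closedAnnulus d a b) (ρ • ω) ω) (uIcc s ‖x‖) ρ := fun ρ hρ => by
    have h1 : HasDerivWithinAt (fun ρ : ℝ => ρ • ω) ω (uIcc s ‖x‖) ρ := by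
      simpa using (hasDerivWithinAt_id ρ _).smul_const ω
    exact (hf _ (hmem ρ hρ)).hasFDerivWithinAt.comp_hasDerivWithinAt ρ h1 hmem
  have hbound : ∀ ρ ∈ uIcc s ‖x‖,
      ‖fderivWithin ℝ f (closedAnnulus d a b) (ρ • ω) ω‖ ≤ B / a := fun ρ hρ => by
    have hρ0 : a ≤ ρ := (hsub hρ).1
    have h1 := hB _ (hmem ρ hρ) (by rwa [hnorm ρ hρ])
    rw [map_smul, smul_eq_mul, abs_mul, abs_of_pos (ha.trans_le hρ0)] at h1
    rw [le_div_iff₀ ha, Real.norm_eq_abs, mul_comm]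
    exact (mul_le_mul_of_nonneg_right hρ0 (abs_nonneg _)).trans h1
  have := (convex_uIcc s ‖x‖).norm_image_sub_le_of_norm_hasDerivWithin_le hderiv hbound
    left_mem_uIcc right_mem_uIcc
  rwa [h0 (s • ω) (hnorm s left_mem_uIcc), sub_zero, hω, smul_smul, mul_inv_cancel₀ hx0.ne',
    one_smul, Real.norm_eq_abs, Real.norm_eq_abs] at this

theorem exists_abs_le_pow_succ (ha : 0 < a) (hab : a < b) {f : EuclideanSpace ℝ (Fin d) → ℝ}
    (hf : DifferentiableOn ℝ f (closedAnnulus d a b)) {K : ℝ} {k : ℕ} (hK : 0 ≤ K)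
    (hK1 : ∀ y ∈ closedAnnulus d a b, |fderivWithin ℝ f (closedAnnulus d a b) y y|
      ≤ K * ((‖y‖ ^ 2 - a ^ 2) * (b ^ 2 - ‖y‖ ^ 2)) ^ k)
    (h0 : ∀ y, ‖y‖ = a ∨ ‖y‖ = b → f y = 0) :
    ∃ K', 0 ≤ K' ∧ ∀ y ∈ closedAnnulus d a b,
      |f y| ≤ K' * ((‖y‖ ^ 2 - a ^ 2) * (b ^ 2 - ‖y‖ ^ 2)) ^ (k + 1) := by
  have hb : 0 < b := ha.trans hab
  have hba : 0 < b - a := sub_pos.2 hab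
  refine ⟨K * (4 * b ^ 3) ^ k / a * (2 / ((b - a) * a ^ 2)) ^ (k + 1), by positivity,
    fun x hx => ?_⟩
  have hfac : ∀ t : ℝ, (t ^ 2 - a ^ 2) * (b ^ 2 - t ^ 2)
      = ((t - a) * (b - t)) * ((t + a) * (b + t)) := fun t => by ring
  have hP0 : ∀ t ∈ Icc a b, 0 ≤ (t ^ 2 - a ^ 2) * (b ^ 2 - t ^ 2) := fun t ht => by
    rw [hfac]
    have h1 := sub_nonneg.2 ht.1
    have h2 := sub_nonneg.2 ht.2
    have h3 := ha.le.trans ht.1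
    positivity
  have hPa : ∀ t ∈ Icc a b, (t ^ 2 - a ^ 2) * (b ^ 2 - t ^ 2) ≤ 4 * b ^ 3 * (t - a) := by
    intro t ht
    have h1 := sub_nonneg.2 ht.1
    have h2 := sub_nonneg.2 ht.2
    have h3 := ha.le.trans ht.1
    calc _ = (t - a) * ((b - t) * ((t + a) * (b + t))) := by ring
      _ ≤ (t - a) * (b * ((b + b) * (b + b))) := by
        gcongr
        · linarith
        · exact ht.2
        · exact ht.2
      _ = _ := by ring
  have hPb : ∀ t ∈ Icc a b, (t ^ 2 - a ^ 2) * (b ^ 2 - t ^ 2) ≤ 4 * b ^ 3 * (b - t) := by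
    intro t ht
    have h1 := sub_nonneg.2 ht.1
    have h2 := sub_nonneg.2 ht.2
    have h3 := ha.le.trans ht.1
    calc _ = (b - t) * ((t - a) * ((t + a) * (b + t))) := by ring
      _ ≤ (b - t) * (b * ((b + b) * (b + b))) := by
        gcongr
        · linarith [ht.2]
        · exact ht.2
        · exact ht.2
      _ = _ := by ring
  have hxa : |f x| ≤ K * (4 * b ^ 3) ^ k / a * (‖x‖ - a) ^ (k + 1) := by
    have := abs_le_of_radial_deriv_le ha hf hx (s := a) (B := K * (4 * b ^ 3 * (‖x‖ - a)) ^ k)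
      ⟨le_rfl, hab.le⟩ (fun y hy hy' => (hK1 y hy).trans ?_) fun y hy => h0 y (Or.inl hy)
    · rw [abs_of_nonneg (sub_nonneg.2 hx.1)] at this
      convert! this using 1
      rw [mul_pow _ (‖x‖ - a), pow_succ (‖x‖ - a)]
      ring
    · rw [uIcc_of_le hx.1] at hy'
      refine mul_le_mul_of_nonneg_left (pow_le_pow_left₀ (hP0 _ hy) ((hPa _ hy).trans ?_) k) hK
      have := hy'.2
      gcongr
  have hxb : |f x| ≤ K * (4 * b ^ 3) ^ k / a * (b - ‖x‖) ^ (k + 1) := by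
    have := abs_le_of_radial_deriv_le ha hf hx (s := b) (B := K * (4 * b ^ 3 * (b - ‖x‖)) ^ k)
      ⟨hab.le, le_rfl⟩ (fun y hy hy' => (hK1 y hy).trans ?_) fun y hy => h0 y (Or.inr hy)
    · rw [abs_sub_comm, abs_of_nonneg (sub_nonneg.2 hx.2)] at this
      convert! this using 1
      rw [mul_pow _ (b - ‖x‖), pow_succ (b - ‖x‖)]
      ring
    · rw [uIcc_of_ge hx.2] at hy'
      refine mul_le_mul_of_nonneg_left (pow_le_pow_left₀ (hP0 _ hy) ((hPb _ hy).trans ?_) k) hK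
      have := hy'.1
      gcongr
  have h1 : 0 ≤ ‖x‖ - a := sub_nonneg.2 hx.1
  have h2 : 0 ≤ b - ‖x‖ := sub_nonneg.2 hx.2
  set m := min (‖x‖ - a) (b - ‖x‖) with hm
  have hm0 : 0 ≤ m := le_min h1 h2
  have hxm : |f x| ≤ K * (4 * b ^ 3) ^ k / a * m ^ (k + 1) := by
    rcases min_choice (‖x‖ - a) (b - ‖x‖) with h | h
    · rwa [hm, h]
    · rwa [hm, h]
  have hmP : m ≤ 2 / ((b - a) * a ^ 2) * ((‖x‖ ^ 2 - a ^ 2) * (b ^ 2 - ‖x‖ ^ 2)) := by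
    rw [div_mul_eq_mul_div, le_div_iff₀ (by positivity), hfac]
    have h3 : m * (b - a) ≤ 2 * ((‖x‖ - a) * (b - ‖x‖)) := by
      have h4 : m * (‖x‖ - a) ≤ (b - ‖x‖) * (‖x‖ - a) :=
        mul_le_mul_of_nonneg_right (min_le_right _ _) h1
      have h5 : m * (b - ‖x‖) ≤ (‖x‖ - a) * (b - ‖x‖) :=
        mul_le_mul_of_nonneg_right (min_le_left _ _) h2
      linarith
    have h6 : a ^ 2 ≤ (‖x‖ + a) * (b + ‖x‖) := by nlinarith [hx.1]
    calc m * ((b - a) * a ^ 2) = m * (b - a) * a ^ 2 := by ring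
      _ ≤ 2 * ((‖x‖ - a) * (b - ‖x‖)) * ((‖x‖ + a) * (b + ‖x‖)) :=
        mul_le_mul h3 h6 (by positivity) (by positivity)
      _ = _ := by ring
  rw [mul_assoc, ← mul_pow]
  exact hxm.trans (mul_le_mul_of_nonneg_left (pow_le_pow_left₀ hm0 hmP _) (by positivity))

theorem exists_radial_deriv_bound (ha : 0 < a) (hab : a < b) {f : EuclideanSpace ℝ (Fin d) → ℝ}
    (hf : ContDiffOn ℝ 1 f (closedAnnulus d a b)) :
    ∃ K, 0 ≤ K ∧ ∀ y ∈ closedAnnulus d a b, |fderivWithin ℝ f (closedAnnulus d a b) y y|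
      ≤ K * ((‖y‖ ^ 2 - a ^ 2) * (b ^ 2 - ‖y‖ ^ 2)) ^ 0 := by
  obtain ⟨K, hK⟩ := isCompact_closedAnnulus.exists_bound_of_continuousOn
    ((hf.continuousOn_fderivWithin (uniqueDiffOn_closedAnnulus ha hab) le_rfl).clm_apply
      continuousOn_id)
  exact ⟨max K 0, le_max_right _ _, fun y hy => by simpa using Or.inl (hK y hy)⟩

theorem exists_continuousOn_eqOn_laplacian (ha : 0 < a) (hab : a < b)
    {f : EuclideanSpace ℝ (Fin d) → ℝ} (hf : ContDiffOn ℝ 2 f (closedAnnulus d a b)) :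
    ∃ σ, ContinuousOn σ (closedAnnulus d a b) ∧ EqOn σ (laplacian f) (annulus d a b) := by
  have hu := uniqueDiffOn_closedAnnulus (d := d) ha hab
  have hc := hf.continuousOn_iteratedFDerivWithin (m := 2) le_rfl hu
  refine ⟨fun x => ∑ i, iteratedFDerivWithin ℝ 2 f (closedAnnulus d a b) x
    ![EuclideanSpace.single i 1, EuclideanSpace.single i 1], ?_, fun x hx => ?_⟩
  · exact continuousOn_finsetSum _ fun i _ =>
      (ContinuousMultilinearMap.apply ℝ (fun _ : Fin 2 => EuclideanSpace ℝ (Fin d)) ℝ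
        ![EuclideanSpace.single i 1, EuclideanSpace.single i 1]).continuous.comp_continuousOn hc
  · simp only [laplacian, iteratedFDerivWithin_eq_iteratedFDeriv hu
      (hf.contDiffAt (closedAnnulus_mem_nhds hx)) (annulus_subset_closedAnnulus hx)]

theorem exists_abs_laplacian_le (ha : 0 < a) (hab : a < b)
    {f : EuclideanSpace ℝ (Fin d) → ℝ} (hf : ContDiffOn ℝ 2 f (closedAnnulus d a b)) :
    ∃ L, ∀ x ∈ annulus d a b, |laplacian f x| ≤ L := by
  obtain ⟨σ, hσ, hσf⟩ := exists_continuousOn_eqOn_laplacian ha hab hf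
  obtain ⟨L, hL⟩ := isCompact_closedAnnulus.exists_bound_of_continuousOn hσ
  exact ⟨L, fun x hx => hσf hx ▸ hL x (annulus_subset_closedAnnulus hx)⟩

theorem integrableOn_mul_laplacian {f u : EuclideanSpace ℝ (Fin d) → ℝ} {M L : ℝ}
    (hf : ContDiffOn ℝ 2 f (annulus d a b)) (hu : ContinuousOn u (annulus d a b))
    (huM : ∀ x ∈ annulus d a b, |u x| ≤ M) (hfL : ∀ x ∈ annulus d a b, |laplacian f x| ≤ L) :
    IntegrableOn (fun x => u x * laplacian f x) (annulus d a b) := by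
  refine integrableOn_annulus (L := M * L) (hu.mul (hf.continuousOn_laplacian isOpen_annulus))
    fun x hx => ?_
  rw [abs_mul]
  exact mul_le_mul (huM x hx) (hfL x hx) (abs_nonneg _) ((abs_nonneg _).trans (huM x hx))

theorem exists_abs_integral_green_le_of_order {G : EuclideanSpace ℝ (Fin d) → ℝ} (ha : 0 < a)
    (hab : a < b) (hG : ContDiffOn ℝ 2 G (closedAnnulus d a b))
    (h0 : ∀ y, ‖y‖ = a ∨ ‖y‖ = b → G y = 0) {K : ℝ} {k : ℕ} (hK : 0 ≤ K)
    (hGK : ∀ y ∈ closedAnnulus d a b, |fderivWithin ℝ G (closedAnnulus d a b) y y|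
      ≤ K * ((‖y‖ ^ 2 - a ^ 2) * (b ^ 2 - ‖y‖ ^ 2)) ^ k) :
    ∃ C, 0 ≤ C ∧ ∀ (u : EuclideanSpace ℝ (Fin d) → ℝ) (M L' : ℝ),
      ContDiffOn ℝ 2 u (annulus d a b) → (∀ x ∈ annulus d a b, |u x| ≤ M) →
      (∀ x ∈ annulus d a b, |laplacian u x| ≤ L') → 0 ≤ M →
      |∫ x in annulus d a b, (G x * laplacian u x - u x * laplacian G x)| ≤ C * M * 0 ^ k := by
  obtain ⟨K', hK', hGK'⟩ :=
    exists_abs_le_pow_succ ha hab (hG.differentiableOn two_ne_zero) hK hGK h0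
  obtain ⟨L, hL⟩ := exists_abs_laplacian_le ha hab hG
  obtain ⟨B, hB⟩ := isCompact_closedAnnulus.exists_bound_of_continuousOn hG.continuousOn
  have hG' := hG.mono annulus_subset_closedAnnulus
  obtain ⟨C, hC, h⟩ := exists_abs_integral_green_le ha hab hG' (K := max K K') (k := k)
    (le_max_of_le_left hK)
    (fun x hx => (hGK' x (annulus_subset_closedAnnulus hx)).trans
      (mul_le_mul_of_nonneg_right (le_max_right _ _)
        (pow_nonneg (norm_sq_sub_mul_pos ha hx).le _)))
    (fun x hx => by
      rw [← fderivWithin_of_mem_nhds (closedAnnulus_mem_nhds hx)]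
      exact (hGK x (annulus_subset_closedAnnulus hx)).trans
        (mul_le_mul_of_nonneg_right (le_max_left _ _)
          (pow_nonneg (norm_sq_sub_mul_pos ha hx).le _))) hL
  exact ⟨C, hC, fun u M L' hu huM huL hM => h u M L' hu huM huL hM
    ((integrableOn_mul_laplacian hu hG'.continuousOn
      (fun x hx => hB x (annulus_subset_closedAnnulus hx)) huL).sub
        (integrableOn_mul_laplacian hG' hu.continuousOn huM hL))⟩

/-- If `G` vanishes on the boundary, the Green pairing with `u` is controlled by `sup |u|`. -/
theorem exists_abs_integral_green_le_mul_bound {G : EuclideanSpace ℝ (Fin d) → ℝ} (ha : 0 < a)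
    (hab : a < b) (hG : ContDiffOn ℝ 2 G (closedAnnulus d a b))
    (h0 : ∀ y, ‖y‖ = a ∨ ‖y‖ = b → G y = 0) :
    ∃ C, 0 ≤ C ∧ ∀ (u : EuclideanSpace ℝ (Fin d) → ℝ) (M L' : ℝ),
      ContDiffOn ℝ 2 u (annulus d a b) → (∀ x ∈ annulus d a b, |u x| ≤ M) →
      (∀ x ∈ annulus d a b, |laplacian u x| ≤ L') → 0 ≤ M →
      |∫ x in annulus d a b, (G x * laplacian u x - u x * laplacian G x)| ≤ C * M := by
  obtain ⟨K, hK, hGK⟩ := exists_radial_deriv_bound ha hab (hG.of_le one_le_two)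
  simpa using exists_abs_integral_green_le_of_order ha hab hG h0 hK hGK

/-- If `G` has zero Cauchy data on the boundary, the Green pairing vanishes. -/
theorem integral_green_eq_zero {G : EuclideanSpace ℝ (Fin d) → ℝ} (ha : 0 < a)
    (hab : a < b) (hG : ContDiffOn ℝ 2 G (closedAnnulus d a b))
    (h0 : ∀ y, ‖y‖ = a ∨ ‖y‖ = b → G y = 0)
    (h1 : ∀ y, ‖y‖ = a ∨ ‖y‖ = b → fderivWithin ℝ G (closedAnnulus d a b) y y = 0)
    {u : EuclideanSpace ℝ (Fin d) → ℝ} (hu : ContDiff ℝ 2 u) :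
    ∫ x in annulus d a b, (G x * laplacian u x - u x * laplacian G x) = 0 := by
  have hW : ContDiffOn ℝ 1 (fun y => fderivWithin ℝ G (closedAnnulus d a b) y y)
      (closedAnnulus d a b) :=
    (hG.fderivWithin (uniqueDiffOn_closedAnnulus ha hab) le_rfl).clm_apply contDiffOn_id
  obtain ⟨K, hK, hWK⟩ := exists_radial_deriv_bound ha hab hW
  obtain ⟨K', hK', hGK⟩ :=
    exists_abs_le_pow_succ ha hab (hW.differentiableOn one_ne_zero) hK hWK h1
  obtain ⟨C, -, hC⟩ := exists_abs_integral_green_le_of_order ha hab hG h0 hK' hGK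
  obtain ⟨M, hM⟩ := isCompact_closedAnnulus.exists_bound_of_continuousOn
    (hu.continuous.continuousOn (s := closedAnnulus d a b))
  obtain ⟨L, hL⟩ := exists_abs_laplacian_le ha hab (hu.contDiffOn (s := closedAnnulus d a b))
  simpa using hC u (max M 0) L hu.contDiffOn
    (fun x hx => (hM x (annulus_subset_closedAnnulus hx)).trans (le_max_left _ _)) hL
    (le_max_right _ _)

end ClosedAnnulus

section Spline

variable {d n : ℕ} {r : Fin (n + 1) → ℝ}

theorem subannulus_subset (hr : StrictMono r) (i : Fin n) :
    annulus d (r i.castSucc) (r i.succ) ⊆ annulus d (r 0) (r (Fin.last n)) := fun _ hx =>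
  ⟨(hr.monotone (Fin.zero_le _)).trans_lt hx.1, hx.2.trans_le (hr.monotone (Fin.le_last _))⟩

theorem closedSubannulus_subset (hr : StrictMono r) (i : Fin n) :
    closedAnnulus d (r i.castSucc) (r i.succ) ⊆ closedAnnulus d (r 0) (r (Fin.last n)) :=
  fun _ hx => ⟨(hr.monotone (Fin.zero_le _)).trans hx.1,
    hx.2.trans (hr.monotone (Fin.le_last _))⟩

theorem exists_mem_subannulus {x : EuclideanSpace ℝ (Fin d)}
    (hx : x ∈ annulus d (r 0) (r (Fin.last n))) (hne : ∀ i, ‖x‖ ≠ r i) :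
    ∃ i : Fin n, x ∈ annulus d (r i.castSucc) (r i.succ) := by
  by_contra! h
  have key : ∀ i, r i < ‖x‖ := fun i => by
    induction i using Fin.induction with
    | zero => exact hx.1
    | succ i ih => exact (not_lt.1 fun h' => h i ⟨ih, h'⟩).lt_of_ne' (hne _)
  exact (key (Fin.last n)).not_gt hx.2

theorem setIntegral_annulus_eq_sum (hr0 : 0 < r 0) (hr : StrictMono r)
    {f : EuclideanSpace ℝ (Fin d) → ℝ}
    (hf : IntegrableOn f (annulus d (r 0) (r (Fin.last n)))) :
    ∫ x in annulus d (r 0) (r (Fin.last n)), f x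
      = ∑ i : Fin n, ∫ x in annulus d (r i.castSucc) (r i.succ), f x := by
  rw [← integral_iUnion_fintype (fun i => isOpen_annulus.measurableSet) ?_
    fun i => hf.mono_set (subannulus_subset hr i)]
  · refine setIntegral_congr_set ?_
    have h0 : ∀ᵐ x : EuclideanSpace ℝ (Fin d), ∀ i, ‖x‖ ≠ r i := by
      refine ae_all_iff.2 fun i => ?_
      have hi : r i ≠ 0 := (hr0.trans_le (hr.monotone (Fin.zero_le i))).ne'
      have := compl_mem_ae_iff.2 (Measure.addHaar_sphere_of_ne_zero volume
        (0 : EuclideanSpace ℝ (Fin d)) hi)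
      filter_upwards [this] with x hx hxi
      exact hx (mem_sphere_zero_iff_norm.2 hxi)
    filter_upwards [h0] with x hx
    refine propext ⟨fun h => mem_iUnion.2 (exists_mem_subannulus h hx), fun h => ?_⟩
    obtain ⟨i, hi⟩ := mem_iUnion.1 h
    exact subannulus_subset hr i hi
  · refine (pairwise_disjoint_on _).2 fun i j hij =>
      disjoint_left.2 fun x hx hx' => ?_
    exact (hx'.1.trans hx.2).not_ge (hr.monotone (Fin.succ_le_castSucc_iff.2 hij))

theorem exists_contDiff_abs_sub_le {a b δ : ℝ} (hδ : 0 < δ)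
    {f : EuclideanSpace ℝ (Fin d) → ℝ} (hf : ContinuousOn f (closedAnnulus d a b)) :
    ∃ Ψ : EuclideanSpace ℝ (Fin d) → ℝ, ContDiff ℝ 2 Ψ ∧
      ∀ x ∈ closedAnnulus d a b, |f x - Ψ x| ≤ δ := by
  obtain ⟨g, hg⟩ := ContinuousMap.exists_restrict_eq
    (isClosed_closedAnnulus (d := d) (a := a) (b := b)) ⟨_, hf.domRestrict⟩
  obtain ⟨Ψ, hΨ, hΨg, -⟩ := g.continuous.exists_contDiff_approx 2 (continuous_const (y := δ))
    fun _ => hδ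
  refine ⟨Ψ, mod_cast hΨ, fun x hx => ?_⟩
  have h1 : g x = f x := congrArg (fun h => h ⟨x, hx⟩) hg
  rw [← h1, abs_sub_comm]
  exact (hΨg x).le

/-- A function harmonic on the subannuli is orthogonal to the Laplacian of a function vanishing on
all the spheres together with its radial derivative on the two outermost ones. -/
theorem integral_mul_laplacian_eq_zero_of_harmonicSpline (hr0 : 0 < r 0) (hr : StrictMono r)
    (hlast : r 0 < r (Fin.last n)) {G ψ : EuclideanSpace ℝ (Fin d) → ℝ}
    (hG : ContDiffOn ℝ 2 G (closedAnnulus d (r 0) (r (Fin.last n))))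
    (h0 : ∀ i y, ‖y‖ = r i → G y = 0)
    (h1 : ∀ y, ‖y‖ = r 0 ∨ ‖y‖ = r (Fin.last n) →
      fderivWithin ℝ G (closedAnnulus d (r 0) (r (Fin.last n))) y y = 0)
    (hψ : HarmonicSpline d n r ψ) :
    ∫ x in annulus d (r 0) (r (Fin.last n)), ψ x * laplacian G x = 0 := by
  have hpos : ∀ i, 0 < r i := fun i => hr0.trans_le (hr.monotone (Fin.zero_le i))
  have hlt : ∀ i : Fin n, r i.castSucc < r i.succ := fun i => hr (Fin.castSucc_lt_succ)
  have h0' : ∀ y, ‖y‖ = r 0 ∨ ‖y‖ = r (Fin.last n) → G y = 0 := by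
    rintro y (h | h)
    · exact h0 _ y h
    · exact h0 _ y h
  choose C _ hC using fun i : Fin n => exists_abs_integral_green_le_mul_bound (hpos i.castSucc)
    (hlt i) (hG.mono (closedSubannulus_subset hr i))
    (fun y hy => hy.elim (h0 _ y) (h0 _ y))
  have hG' := hG.mono annulus_subset_closedAnnulus
  obtain ⟨LG, hLG⟩ := exists_abs_laplacian_le hr0 hlast hG
  obtain ⟨BG, hBG⟩ := isCompact_closedAnnulus.exists_bound_of_continuousOn hG.continuousOn
  obtain ⟨Bψ, hBψ⟩ := isCompact_closedAnnulus.exists_bound_of_continuousOn hψ.1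
  have hψi : IntegrableOn (fun x => ψ x * laplacian G x) (annulus d (r 0) (r (Fin.last n))) :=
    integrableOn_mul_laplacian hG' (hψ.1.mono annulus_subset_closedAnnulus)
      (fun x hx => hBψ x (annulus_subset_closedAnnulus hx)) hLG
  have key : ∀ δ > 0,
      |∫ x in annulus d (r 0) (r (Fin.last n)), ψ x * laplacian G x| ≤ δ * ∑ i, C i := by
    intro δ hδ
    obtain ⟨Ψ, hΨ, hψΨ⟩ := exists_contDiff_abs_sub_le hδ hψ.1
    obtain ⟨LΨ, hLΨ⟩ := exists_abs_laplacian_le hr0 hlast hΨ.contDiffOn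
    obtain ⟨BΨ, hBΨ⟩ := (isCompact_closedAnnulus (d := d) (a := r 0)
      (b := r (Fin.last n))).exists_bound_of_continuousOn hΨ.continuous.continuousOn
    have hΨi : IntegrableOn (fun x => G x * laplacian Ψ x - Ψ x * laplacian G x)
        (annulus d (r 0) (r (Fin.last n))) :=
      (integrableOn_mul_laplacian hΨ.contDiffOn hG'.continuousOn
        (fun x hx => hBG x (annulus_subset_closedAnnulus hx)) hLΨ).sub
      (integrableOn_mul_laplacian hG' hΨ.continuous.continuousOn
        (fun x hx => hBΨ x (annulus_subset_closedAnnulus hx)) hLG)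
    have hsum : -∫ x in annulus d (r 0) (r (Fin.last n)), ψ x * laplacian G x
        = ∑ i : Fin n, ∫ x in annulus d (r i.castSucc) (r i.succ),
          (G x * laplacian (fun y => ψ y - Ψ y) x - (ψ x - Ψ x) * laplacian G x) := by
      have hneg : IntegrableOn (fun x => -(ψ x * laplacian G x))
          (annulus d (r 0) (r (Fin.last n))) := hψi.neg
      have hgreen := integral_green_eq_zero hr0 hlast hG h0' h1 hΨ
      rw [← sub_zero (-∫ x in _, _), ← hgreen, ← integral_neg, ← integral_sub hneg hΨi]
      refine (setIntegral_annulus_eq_sum hr0 hr (hneg.sub hΨi)).trans ?_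
      refine Finset.sum_congr rfl fun i _ => setIntegral_congr_fun isOpen_annulus.measurableSet
        fun x hx => ?_
      have hψx := (hψ.2 i).1.contDiffAt (isOpen_annulus.mem_nhds hx)
      simp only [Pi.sub_apply]
      rw [laplacian_sub_of_contDiffAt hψx hΨ.contDiffAt, (hψ.2 i).2 x hx]
      ring
    rw [← abs_neg, hsum, Finset.mul_sum]
    refine (Finset.abs_sum_le_sum_abs _ _).trans (Finset.sum_le_sum fun i _ => ?_)
    rw [mul_comm δ]
    refine hC i _ δ LΨ ((hψ.2 i).1.sub hΨ.contDiffOn) (fun x hx => hψΨ x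
      (annulus_subset_closedAnnulus (subannulus_subset hr i hx))) (fun x hx => ?_) hδ.le
    rw [laplacian_sub_of_contDiffAt ((hψ.2 i).1.contDiffAt (isOpen_annulus.mem_nhds hx))
      hΨ.contDiffAt, (hψ.2 i).2 x hx, zero_sub, abs_neg]
    exact hLΨ x (subannulus_subset hr i hx)
  refine abs_nonpos_iff.1 (ge_of_tendsto (x := 𝓝[>] (0 : ℝ)) (f := fun δ => δ * ∑ i, C i) ?_
    (eventually_mem_nhdsWithin.mono key))
  have : Tendsto (fun δ : ℝ => δ * ∑ i, C i) (𝓝 0) (𝓝 (0 * ∑ i, C i)) :=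
    tendsto_id.mul_const _
  rw [zero_mul] at this
  exact this.mono_left nhdsWithin_le_nhds

end Spline

/-- `Δ I₄(F)` is the best `L²` approximation of `ΔF` among harmonic splines. -/
theorem biharmonic_spline_best_approximation
    (d n : ℕ) (hd : 2 ≤ d) (hn : 1 ≤ n) (r : Fin (n + 1) → ℝ)
    (hr0 : 0 < r 0) (hr : StrictMono r)
    (F S : EuclideanSpace ℝ (Fin d) → ℝ)
    (hF : ContDiffOn ℝ 4 F (closedAnnulus d (r 0) (r (Fin.last n))))
    (hS : BiharmonicSpline d n r S)
    (hinterp : ∀ (i : Fin (n + 1)) (x : EuclideanSpace ℝ (Fin d)), ‖x‖ = r i → S x = F x)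
    (hnormal : ∀ x : EuclideanSpace ℝ (Fin d), (‖x‖ = r 0 ∨ ‖x‖ = r (Fin.last n)) →
      fderivWithin ℝ S (closedAnnulus d (r 0) (r (Fin.last n))) x x =
      fderivWithin ℝ F (closedAnnulus d (r 0) (r (Fin.last n))) x x)
    (φ : EuclideanSpace ℝ (Fin d) → ℝ) (hφ : HarmonicSpline d n r φ) :
    Real.sqrt (∫ x in annulus d (r 0) (r (Fin.last n)),
        (laplacian F x - laplacian S x) ^ 2) ≤
      Real.sqrt (∫ x in annulus d (r 0) (r (Fin.last n)),
        (laplacian F x - φ x) ^ 2) := by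
  have hlast : r 0 < r (Fin.last n) := hr (by rw [Fin.lt_def]; exact hn)
  have hF2 : ContDiffOn ℝ 2 F (closedAnnulus d (r 0) (r (Fin.last n))) :=
    hF.of_le (by norm_num)
  have hG : ContDiffOn ℝ 2 (fun x => F x - S x) (closedAnnulus d (r 0) (r (Fin.last n))) :=
    hF2.sub hS.1
  have hΔG : ∀ x ∈ annulus d (r 0) (r (Fin.last n)),
      laplacian (fun x => F x - S x) x = laplacian F x - laplacian S x := fun x hx =>
    laplacian_sub_of_contDiffAt (hF2.contDiffAt (closedAnnulus_mem_nhds hx))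
      (hS.1.contDiffAt (closedAnnulus_mem_nhds hx))
  obtain ⟨σ, hσ, hσS⟩ := exists_continuousOn_eqOn_laplacian hr0 hlast hS.1
  have hψ : HarmonicSpline d n r fun x => σ x - φ x := by
    refine ⟨hσ.sub hφ.1, fun i => ?_⟩
    have hΔS : ContDiffOn ℝ 2 (laplacian S) (annulus d (r i.castSucc) (r i.succ)) :=
      (hS.2 i).1.laplacian isOpen_annulus (by norm_num)
    have hσi : EqOn σ (laplacian S) (annulus d (r i.castSucc) (r i.succ)) :=
      hσS.mono (subannulus_subset hr i)
    refine ⟨(hΔS.congr hσi).sub (hφ.2 i).1, fun x hx => ?_⟩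
    have hnhds := isOpen_annulus.mem_nhds hx
    rw [laplacian_sub_of_contDiffAt ((hΔS.congr hσi).contDiffAt hnhds)
      ((hφ.2 i).1.contDiffAt hnhds), (hφ.2 i).2 x hx,
      laplacian_congr_of_eventuallyEq (hσi.eventuallyEq_of_mem hnhds), (hS.2 i).2 x hx, sub_zero]
  have horth := integral_mul_laplacian_eq_zero_of_harmonicSpline hr0 hr hlast hG
    (fun i y hy => sub_eq_zero.2 (hinterp i y hy).symm) (fun y hy => ?_) hψ
  · obtain ⟨L, hL⟩ := exists_abs_laplacian_le hr0 hlast hG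
    obtain ⟨B, hB⟩ := isCompact_closedAnnulus.exists_bound_of_continuousOn hψ.1
    have hG' := hG.mono annulus_subset_closedAnnulus
    have hψ' := hψ.1.mono annulus_subset_closedAnnulus
    have hB' : ∀ x ∈ annulus d (r 0) (r (Fin.last n)), |σ x - φ x| ≤ B :=
      fun x hx => hB x (annulus_subset_closedAnnulus hx)
    have hcross := integrableOn_mul_laplacian hG' hψ' hB' hL
    have hGG : IntegrableOn (fun x => laplacian (fun y => F y - S y) x ^ 2)
        (annulus d (r 0) (r (Fin.last n))) := by
      simpa only [sq] using integrableOn_mul_laplacian hG'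
        (hG'.continuousOn_laplacian isOpen_annulus) hL hL
    have hψψ : IntegrableOn (fun x => (σ x - φ x) ^ 2) (annulus d (r 0) (r (Fin.last n))) :=
      integrableOn_annulus (L := B ^ 2) (hψ'.pow 2) fun x hx => by
        rw [abs_pow]
        exact pow_le_pow_left₀ (abs_nonneg _) (hB' x hx) 2
    have hsum : IntegrableOn (fun x => laplacian (fun y => F y - S y) x ^ 2
        + 2 * ((σ x - φ x) * laplacian (fun y => F y - S y) x))
        (annulus d (r 0) (r (Fin.last n))) := hGG.add (hcross.const_mul 2)
    have hm : MeasurableSet (annulus d (r 0) (r (Fin.last n))) := isOpen_annulus.measurableSet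
    refine Real.sqrt_le_sqrt ?_
    calc ∫ x in annulus d (r 0) (r (Fin.last n)), (laplacian F x - laplacian S x) ^ 2
        = ∫ x in annulus d (r 0) (r (Fin.last n)), laplacian (fun y => F y - S y) x ^ 2 :=
          setIntegral_congr_fun hm fun x hx => by simp only [hΔG x hx]
      _ ≤ (∫ x in annulus d (r 0) (r (Fin.last n)), laplacian (fun y => F y - S y) x ^ 2)
          + 2 * (∫ x in annulus d (r 0) (r (Fin.last n)),
            (σ x - φ x) * laplacian (fun y => F y - S y) x)
          + ∫ x in annulus d (r 0) (r (Fin.last n)), (σ x - φ x) ^ 2 := by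
        rw [horth, mul_zero, add_zero]
        exact le_add_of_nonneg_right (integral_nonneg fun x => sq_nonneg _)
      _ = ∫ x in annulus d (r 0) (r (Fin.last n)), (laplacian F x - φ x) ^ 2 := by
        rw [← integral_const_mul, ← integral_add hGG (hcross.const_mul 2),
          ← integral_add hsum hψψ]
        refine setIntegral_congr_fun hm fun x hx => ?_
        simp only [hΔG x hx, hσS hx]
        ring
  · have hy' : y ∈ closedAnnulus d (r 0) (r (Fin.last n)) := by
      rcases hy with h | h
      · exact ⟨h.ge, h.le.trans hlast.le⟩
      · exact ⟨hlast.le.trans h.ge, h.le⟩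
    rw [fderivWithin_fun_sub (uniqueDiffOn_closedAnnulus hr0 hlast y hy')
      (hF2.differentiableOn two_ne_zero y hy') (hS.1.differentiableOn two_ne_zero y hy'),
      sub_apply, hnormal y hy, sub_self]
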